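/- (Theorem 2, part 3) If p is a polynomial of degree exactly n+1 such that ⟨p|q⟩ = 0 for every polynomial q of degree at most n, then p(x_i) = 0 for every i ∈ {1,…,n+1}; i.e., the nodes are roots of any nontrivial degree-(n+1) polynomial orthogonal to all polynomials of degree at most n. -/

import Mathlib

open Polynomial MeasureTheory

/-- The functional `f ↦ ∫ t in a..b, w t * f t` on polynomials. -/
noncomputable def weightedIntegral (a b : ℝ) (w : ℝ → ℝ)
    (hw : IntervalIntegrable w volume a b) : ℝ[X] →ₗ[ℝ] ℝ where
  toFun f := ∫ t in a..b, w t * f.eval t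
  map_add' f g := by
    simp only [eval_add, mul_add]
    exact intervalIntegral.integral_add (hw.mul_continuousOn f.continuousOn)
      (hw.mul_continuousOn g.continuousOn)
  map_smul' c f := by
    simp only [eval_smul, smul_eq_mul, RingHom.id_apply, mul_left_comm _ c]
    exact intervalIntegral.integral_const_mul _ _

theorem weightedIntegral_apply {a b : ℝ} {w : ℝ → ℝ}
    (hw : IntervalIntegrable w volume a b) (f : ℝ[X]) :
    weightedIntegral a b w hw f = ∫ t in a..b, w t * f.eval t :=
  rfl

theorem eq_zero_of_weightedIntegral_mul_self_eq_zero {a b : ℝ} (hab : a < b) {w : ℝ → ℝ}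
    (hw : IntervalIntegrable w volume a b) (hw_cont : ContinuousOn w (Set.Icc a b))
    (hw_pos : ∀ t ∈ Set.Ioo a b, 0 < w t) {f : ℝ[X]}
    (hf : weightedIntegral a b w hw (f * f) = 0) : f = 0 := by
  have hcont : ContinuousOn (fun t => w t * (f * f).eval t) (Set.Icc a b) :=
    hw_cont.mul (f * f).continuousOn
  have hroot : ∀ t ∈ Set.Ioo a b, f.eval t = 0 := by
    intro t ht
    by_contra hne
    refine hf.not_gt (intervalIntegral.integral_pos hab hcont ?_
      ⟨t, Set.Ioo_subset_Icc_self ht, ?_⟩)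
    · intro s hs
      have hw_nonneg : 0 ≤ w s := by
        replace hs := Set.Ioc_subset_Icc_self hs
        rw [← closure_Ioo hab.ne] at hs hw_cont
        exact closure_minimal (Set.image_subset_iff.mpr fun r hr => (hw_pos r hr).le) isClosed_Ici
          (hw_cont.image_closure (Set.mem_image_of_mem w hs))
      rw [eval_mul]
      exact mul_nonneg hw_nonneg (mul_self_nonneg _)
    · rw [eval_mul]
      exact mul_pos (hw_pos t ht) (mul_self_pos.mpr hne)
  exact eq_zero_of_infinite_isRoot f ((Set.Ioo_infinite hab).mono hroot)

theorem span_range_eq_degreeLT {K : Type*} [Field K] {m : ℕ} {u : Fin m → K[X]}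
    (hu : LinearIndependent K u) (hdeg : ∀ i, u i ∈ degreeLT K m) :
    Submodule.span K (Set.range u) = degreeLT K m := by
  have := Module.Finite.equiv (degreeLTEquiv K m).symm
  refine Submodule.eq_of_le_of_finrank_eq (Submodule.span_le.mpr ?_) ?_
  · rintro _ ⟨i, rfl⟩
    exact hdeg i
  · rw [finrank_span_eq_card hu, (degreeLTEquiv K m).finrank_eq, Module.finrank_fin_fun,
      Fintype.card_fin]

theorem linearIndependent_of_map_mul_eq_ite {K ι : Type*} [Field K] [DecidableEq ι]
    (L : K[X] →ₗ[K] K) {u : ι → K[X]} (hu : ∀ i j, L (u i * u j) = if i = j then 1 else 0) :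
    LinearIndependent K u := by
  rw [linearIndependent_iff']
  intro s g hg j hj
  have h := congrArg (fun f => L (f * u j)) hg
  simpa [Finset.sum_mul, hu, hj] using h

/-- A polynomial of degree at most `m` orthogonal to all polynomials of degree less than `m` is a
multiple of any polynomial of degree `m` with this property. -/
theorem exists_eq_C_mul_of_orthogonal {K : Type*} [Field K] {m : ℕ} (L : K[X] →ₗ[K] K)
    (hL : ∀ f, L (f * f) = 0 → f = 0) {p r : K[X]} (hp : p.degree = m) (hr : r.degree ≤ m)
    (hp_orth : ∀ q ∈ degreeLT K m, L (p * q) = 0) (hr_orth : ∀ q ∈ degreeLT K m, L (r * q) = 0) :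
    ∃ c, r = C c * p := by
  have hlead : p.coeff m ≠ 0 := coeff_ne_zero_of_eq_degree hp
  refine ⟨r.coeff m / p.coeff m, sub_eq_zero.mp (hL _ ?_)⟩
  set c := r.coeff m / p.coeff m with hc
  have hmem : r - C c * p ∈ degreeLT K m := by
    rw [mem_degreeLT, degree_lt_iff_coeff_zero]
    intro k hk
    rw [coeff_sub, coeff_C_mul]
    rcases hk.eq_or_lt with rfl | hk
    · rw [hc, div_mul_cancel₀ _ hlead, sub_self]
    · have hk' : (m : WithBot ℕ) < k := by exact_mod_cast hk
      rw [coeff_eq_zero_of_degree_lt (hr.trans_lt hk'),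
        coeff_eq_zero_of_degree_lt (hp.trans_lt hk'), mul_zero, sub_zero]
  conv_lhs => rw [sub_mul, map_sub, hr_orth _ hmem, mul_assoc,
    ← smul_eq_C_mul, map_smul, hp_orth _ hmem]
  simp

/-- **Theorem 2, part 3.** The nodes are roots of any degree-`(n+1)` polynomial
that is orthogonal to all polynomials of degree at most `n`. -/
theorem nodes_are_roots_of_orthogonal_polynomial
(n : ℕ) (a b : ℝ) (hab : a < b)
    (w : ℝ → ℝ) (hw_cont : ContinuousOn w (Set.Icc a b))
    (hw_pos : ∀ t ∈ Set.Ioo a b, 0 < w t)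
    (u : Fin (n + 1) → Polynomial ℝ) (hu_deg : ∀ i, (u i).natDegree ≤ n)
    (x : Fin (n + 1) → ℝ)
    (horth : ∀ i j, (∫ t in a..b, w t * (u i).eval t * (u j).eval t)
      = if i = j then 1 else 0)
    (heig : ∀ i j, (∫ t in a..b, w t * t * (u i).eval t * (u j).eval t)
      = if i = j then x i else 0)
    (p : Polynomial ℝ) (hp_deg : p.natDegree = n + 1)
    (hp_orth : ∀ q : Polynomial ℝ, q.natDegree ≤ n →
      (∫ t in a..b, w t * p.eval t * q.eval t) = 0)
    (i : Fin (n + 1)) :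
    p.eval (x i) = 0 := by
  have hw : IntervalIntegrable w volume a b := hw_cont.intervalIntegrable_of_Icc hab.le
  set L := weightedIntegral a b w hw with hL
  have hL_orth : ∀ i j, L (u i * u j) = if i = j then 1 else 0 := fun i j => by
    simpa only [hL, weightedIntegral_apply, eval_mul, mul_assoc] using horth i j
  have hL_eig : ∀ i j, L (X * (u i * u j)) = if i = j then x i else 0 := fun i j => by
    simpa only [hL, weightedIntegral_apply, eval_mul, eval_X, mul_assoc] using heig i j
  have hu_mem : ∀ j, u j ∈ degreeLT ℝ (n + 1) := fun j =>
    mem_degreeLT.mpr (degree_le_natDegree.trans_lt (by exact_mod_cast Nat.lt_succ_of_le (hu_deg j)))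
  have hspan := span_range_eq_degreeLT (linearIndependent_of_map_mul_eq_ite L hL_orth) hu_mem
  have hu_ne : u i ≠ 0 := fun h => by simpa [h] using hL_orth i i
  have hr_deg : ((X - C (x i)) * u i).degree ≤ ((n + 1 : ℕ) : WithBot ℕ) := by
    refine degree_le_of_natDegree_le (natDegree_mul_le.trans ?_)
    rw [natDegree_X_sub_C, add_comm]
    exact Nat.add_le_add_right (hu_deg i) 1
  have hr_orth : ∀ q ∈ degreeLT ℝ (n + 1), L ((X - C (x i)) * u i * q) = 0 := by
    intro q hq
    rw [← hspan] at hq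
    induction hq using Submodule.span_induction with
    | mem q hq =>
      obtain ⟨j, rfl⟩ := hq
      rw [mul_assoc, sub_mul, map_sub, hL_eig, ← smul_eq_C_mul, map_smul, hL_orth]
      split_ifs <;> simp
    | zero => simp
    | add f g _ _ hf hg => rw [mul_add, map_add, hf, hg, add_zero]
    | smul c f _ hf => rw [mul_smul_comm, map_smul, hf, smul_zero]
  have hp : p.degree = (n + 1 : ℕ) := (degree_eq_iff_natDegree_eq_of_pos n.succ_pos).mpr hp_deg
  have hL_p : ∀ q ∈ degreeLT ℝ (n + 1), L (p * q) = 0 := fun q hq => by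
    simpa only [hL, weightedIntegral_apply, eval_mul, mul_assoc] using
      hp_orth q (natDegree_le_iff_coeff_eq_zero.mpr fun k hk =>
        (degree_lt_iff_coeff_zero _ _).mp (mem_degreeLT.mp hq) k hk)
  obtain ⟨c, hc⟩ := exists_eq_C_mul_of_orthogonal L
    (fun f => eq_zero_of_weightedIntegral_mul_self_eq_zero hab hw hw_cont hw_pos)
    hp hr_deg hL_p hr_orth
  have hc_ne : c ≠ 0 := by
    rintro rfl
    rw [C_0, zero_mul] at hc
    exact mul_ne_zero (X_sub_C_ne_zero (x i)) hu_ne hc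
  have heval := congrArg (eval (x i)) hc
  simpa [hc_ne] using heval
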